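/- arXiv:math/0609131 — 5 statements merged into one kernel-verified Lean document; each statement's English description precedes it below -/
import Mathlib

section
/- Given two integers n and k with n ≥ k > 1, a non-decreasing sequence R = [r₁, r₂, …, rₙ] of non-negative integers is the losing score sequence of some k-hypertournament on n vertices if and only if for each j with 1 ≤ j ≤ n, ∑_{i=1}^{j} rᵢ ≥ C(j, k), with equality when j = n. (Here C(p, q) = p!/(q!(p−q)!) if p ≥ q and C(p, q) = 0 if p < q.) -/
/-- A `k`-hypertournament on `n` vertices: for each `k`-element subset `S` of the
vertex set `Fin n`, there is exactly one arc, a linear arrangement (duplicate-free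
list) of the vertices whose entries are exactly the elements of `S`. -/
structure Hypertournament (n k : ℕ) where
  arc : Finset (Fin n) → List (Fin n)
  nodup : ∀ S : Finset (Fin n), S.card = k → (arc S).Nodup
  toFinset_arc : ∀ S : Finset (Fin n), S.card = k → (arc S).toFinset = S

/-- The losing score of a vertex `v`: the number of arcs containing `v` in which
`v` is the last entry. -/
def losingScore {n k : ℕ} (H : Hypertournament n k) (v : Fin n) : ℕ :=
  ((Finset.univ.powersetCard k).filter
    (fun S : Finset (Fin n) => (H.arc S).getLast? = some v)).card

open Finset in
/-- For a monotone `r`, the sum over any set of indices is at least the sum over the initial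
segment of the same size. -/
theorem sum_initial_le_sum_of_monotone {n : ℕ} {r : Fin n → ℕ} (hr : Monotone r)
    (U : Finset (Fin n)) :
    ∑ i ∈ univ.filter (fun i : Fin n => (i : ℕ) < U.card), r i ≤ ∑ i ∈ U, r i := by
  have hUn : U.card ≤ n := by simpa using U.card_le_univ
  set A := univ.filter (fun i : Fin n => (i : ℕ) < U.card) with hA
  have hcard : A.card = U.card := by
    rw [hA, Fin.card_filter_val_lt, min_eq_right hUn]
  rcases hUn.eq_or_lt with h | h
  · rw [(card_eq_iff_eq_univ U).1 (by simpa using h)]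
    exact sum_le_sum_of_subset (subset_univ _)
  · have hsdiff : (A \ U).card = (U \ A).card := card_sdiff_comm hcard
    rw [← sum_inter_add_sum_sdiff A U, ← sum_inter_add_sum_sdiff U A, inter_comm U A]
    refine Nat.add_le_add_left ?_ _
    calc ∑ i ∈ A \ U, r i ≤ (A \ U).card • r ⟨U.card, h⟩ := by
          refine sum_le_card_nsmul _ _ _ fun i hi => hr ?_
          simp only [hA, mem_sdiff, mem_filter, mem_univ, true_and] at hi
          exact Fin.le_def.2 hi.1.le
      _ = (U \ A).card • r ⟨U.card, h⟩ := by rw [hsdiff]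
      _ ≤ ∑ i ∈ U \ A, r i := by
          refine card_nsmul_le_sum _ _ _ fun i hi => hr ?_
          simp only [hA, mem_sdiff, mem_filter, mem_univ, true_and, not_lt] at hi
          exact Fin.le_def.2 hi.2

namespace Hypertournament

open Finset

variable {n k : ℕ}

theorem exists_getLast?_eq (H : Hypertournament n k) (hk : 0 < k) {S : Finset (Fin n)}
    (hS : S.card = k) : ∃ v ∈ S, (H.arc S).getLast? = some v := by
  have hne : H.arc S ≠ [] := by
    intro h
    have := H.toFinset_arc S hS
    rw [h, List.toFinset_nil] at this
    rw [← this, card_empty] at hS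
    omega
  refine ⟨(H.arc S).getLast hne, ?_, List.getLast?_eq_getLast_of_ne_nil hne⟩
  have hmem := List.mem_toFinset.2 (List.getLast_mem hne)
  rwa [H.toFinset_arc S hS] at hmem

theorem choose_card_le_sum_losingScore (H : Hypertournament n k) (hk : 0 < k)
    (T : Finset (Fin n)) : T.card.choose k ≤ ∑ v ∈ T, losingScore H v := by
  rw [← card_powersetCard]
  refine (card_le_card fun S hS => ?_).trans card_biUnion_le
  rw [mem_powersetCard] at hS
  obtain ⟨v, hv, hlast⟩ := H.exists_getLast?_eq hk hS.2
  simp only [mem_biUnion, mem_filter, mem_powersetCard]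
  exact ⟨v, hS.1 hv, ⟨subset_univ _, hS.2⟩, hlast⟩

theorem sum_losingScore (H : Hypertournament n k) (hk : 0 < k) :
    ∑ v, losingScore H v = n.choose k := by
  refine le_antisymm ?_ (by simpa using H.choose_card_le_sum_losingScore hk univ)
  unfold losingScore
  rw [← card_biUnion]
  · refine (card_le_card (t := univ.powersetCard k) ?_).trans (by simp)
    exact biUnion_subset.2 fun _ _ => filter_subset _ _
  · intro v _ w _ hvw
    refine disjoint_filter.2 fun S _ hv hw => hvw ?_
    exact Option.some_injective _ (hv.symm.trans hw)

/-- A hypertournament in which the last entry of the arc on `S` is the chosen vertex `f S`. -/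
noncomputable def ofLast (f : Finset (Fin n) → Fin n)
    (hf : ∀ S : Finset (Fin n), S.card = k → f S ∈ S) : Hypertournament n k where
  arc S := (S.erase (f S)).toList ++ [f S]
  nodup S _ := by
    rw [← List.concat_eq_append]
    exact (nodup_toList _).concat (by simp)
  toFinset_arc S hS := by
    ext v
    by_cases h : v = f S
    · simp [h, hf S hS]
    · simp [h]

theorem losingScore_ofLast (f : Finset (Fin n) → Fin n)
    (hf : ∀ S : Finset (Fin n), S.card = k → f S ∈ S) (v : Fin n) :
    losingScore (ofLast f hf) v = ((univ.powersetCard k).filter (fun S => f S = v)).card := by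
  simp [losingScore, ofLast]

/-- If every set `U` of vertices satisfies `C(|U|, k) ≤ ∑ i ∈ U, r i`, with equality for the full
vertex set, then by Hall's theorem `r` lists the losing scores of a hypertournament. -/
theorem exists_losingScore_eq (r : Fin n → ℕ)
    (hle : ∀ U : Finset (Fin n), U.card.choose k ≤ ∑ i ∈ U, r i)
    (hsum : ∑ i, r i = n.choose k) :
    ∃ H : Hypertournament n k, ∀ v, losingScore H v = r v := by
  classical
  let t : {S : Finset (Fin n) // S.card = k} → Finset (Σ i : Fin n, Fin (r i)) :=
    fun S => S.1.sigma fun _ => univ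
  have hall : ∀ s : Finset {S : Finset (Fin n) // S.card = k},
      s.card ≤ (s.biUnion t).card := by
    intro s
    set U := s.biUnion Subtype.val with hU
    have hst : s.biUnion t = U.sigma fun _ => univ := by
      ext ⟨i, a⟩
      simp [t, hU]
    rw [hst, card_sigma]
    simp only [card_univ, Fintype.card_fin]
    refine le_trans ?_ (hle U)
    rw [← card_powersetCard, ← card_map (Function.Embedding.subtype _)]
    refine card_le_card fun _ hT => ?_
    obtain ⟨S, hS, rfl⟩ := mem_map.1 hT
    exact mem_powersetCard.2 ⟨subset_biUnion_of_mem Subtype.val hS, S.2⟩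
  obtain ⟨g, hg, hgt⟩ := (all_card_le_biUnion_card_iff_exists_injective t).1 hall
  have hbij : Function.Bijective g := by
    refine (Fintype.bijective_iff_injective_and_card g).2 ⟨hg, ?_⟩
    simp [Fintype.card_finset_len, hsum]
  have hmem : ∀ S, (g S).1 ∈ S.1 := fun S => (mem_sigma.1 (hgt S)).1
  rcases isEmpty_or_nonempty (Fin n) with hn | ⟨⟨v₀⟩⟩
  · refine ⟨⟨fun _ => [], fun _ _ => List.nodup_nil, fun S _ => Subsingleton.elim _ _⟩, fun v => ?_⟩
    exact hn.elim v
  let f : Finset (Fin n) → Fin n := fun S => if h : S.card = k then (g ⟨S, h⟩).1 else v₀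
  have hf : ∀ S (h : S.card = k), f S = (g ⟨S, h⟩).1 := fun S h => dif_pos h
  refine ⟨ofLast f fun S h => hf S h ▸ hmem ⟨S, h⟩, fun v => ?_⟩
  rw [losingScore_ofLast]
  trans (univ : Finset (Fin (r v))).card
  · symm
    let e := Equiv.ofBijective g hbij
    have he : ∀ a, g (e.symm a) = a := e.apply_symm_apply
    refine card_bij (fun a _ => (e.symm ⟨v, a⟩).1) ?_ ?_ ?_
    · intro a _
      rw [mem_filter, mem_powersetCard, hf _ (e.symm ⟨v, a⟩).2]
      exact ⟨⟨subset_univ _, (e.symm ⟨v, a⟩).2⟩, by rw [Subtype.coe_eta, he]⟩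
    · intro a _ b _ hab
      simpa using e.symm.injective (Subtype.ext hab)
    · intro S hS
      simp only [mem_filter, mem_powersetCard] at hS
      obtain ⟨⟨-, hSk⟩, hSv⟩ := hS
      rw [hf S hSk] at hSv
      subst hSv
      exact ⟨(g ⟨S, hSk⟩).2, mem_univ _, congrArg Subtype.val (e.symm_apply_apply ⟨S, hSk⟩)⟩
  · simp

end Hypertournament

/-- **Theorem 2 (Zhou, Yao, Zhang).** Given integers `n ≥ k > 1`, a non-decreasing
sequence `r` of non-negative integers is the losing score sequence of some
`k`-hypertournament on `n` vertices iff every prefix sum of length `j` is at least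
`C(j, k)`, with equality for `j = n`. -/
theorem losing_score_sequence_iff (n k : ℕ) (hk : 1 < k) (hkn : k ≤ n)
    (r : Fin n → ℕ) (hr : Monotone r) :
    (∃ H : Hypertournament n k, ∃ σ : Equiv.Perm (Fin n),
        ∀ i : Fin n, r i = losingScore H (σ i)) ↔
      ((∀ j : ℕ, 1 ≤ j → j ≤ n →
          Nat.choose j k ≤ ∑ i ∈ Finset.univ.filter (fun i : Fin n => (i : ℕ) < j), r i) ∧
        ∑ i : Fin n, r i = Nat.choose n k) := by
  have hk0 : 0 < k := by omega
  constructor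
  · rintro ⟨H, σ, h⟩
    simp only [h]
    refine ⟨fun j _ hj => ?_, ?_⟩
    · have key := H.choose_card_le_sum_losingScore hk0
        ((Finset.univ.filter (fun i : Fin n => (i : ℕ) < j)).map σ.toEmbedding)
      rw [Finset.card_map, Finset.sum_map, Fin.card_filter_val_lt, min_eq_right hj] at key
      exact key
    · rw [Equiv.sum_comp σ (losingScore H)]
      exact H.sum_losingScore hk0
  · rintro ⟨hle, hsum⟩
    have hU (U : Finset (Fin n)) : U.card.choose k ≤ ∑ i ∈ U, r i := by
      rcases U.card.eq_zero_or_pos with h | h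
      · rw [h, Nat.choose_eq_zero_of_lt hk0]
        exact Nat.zero_le _
      · exact (hle _ h (by simpa using U.card_le_univ)).trans
          (sum_initial_le_sum_of_monotone hr U)
    obtain ⟨H, hH⟩ := Hypertournament.exists_losingScore_eq r hU hsum
    exact ⟨H, 1, fun i => (hH i).symm⟩
end

section
/- Let n and k be integers with n ≥ k > 1, and let H be a k-hypertournament on n vertices with losing scores listed in non-decreasing order as r₁ ≤ r₂ ≤ … ≤ rₙ. Then for each j with 1 ≤ j ≤ n, ∑_{i=1}^{j} rᵢ ≥ C(j, k), and ∑_{i=1}^{n} rᵢ = C(n, k). -/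
/-- The last entry of the arc on a nonempty `k`-set exists and lies in that set. -/
theorem Hypertournament.exists_getLast?_arc {n k : ℕ} (H : Hypertournament n k) (hk : 0 < k)
    {S : Finset (Fin n)} (hS : S.card = k) : ∃ v ∈ S, (H.arc S).getLast? = some v := by
  have hne : H.arc S ≠ [] := by
    intro h
    have h' := H.toFinset_arc S hS
    rw [h, List.toFinset_nil] at h'
    rw [← h', Finset.card_empty] at hS
    omega
  refine ⟨(H.arc S).getLast hne, ?_, List.getLast?_eq_some_getLast hne⟩
  have hmem := List.mem_toFinset.mpr (List.getLast_mem hne)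
  rwa [H.toFinset_arc S hS] at hmem

/-- The losing scores over a vertex set `T` count the arcs whose last entry lies in `T`. -/
theorem sum_losingScore {n k : ℕ} (H : Hypertournament n k) (T : Finset (Fin n)) :
    ∑ v ∈ T, losingScore H v = ((Finset.univ.powersetCard k).filter
      (fun S : Finset (Fin n) => ∃ v ∈ T, (H.arc S).getLast? = some v)).card := by
  unfold losingScore
  rw [← Finset.card_biUnion]
  · congr 1
    ext S
    simp only [Finset.mem_biUnion, Finset.mem_filter]
    tauto
  · intro v _ w _ hvw
    rw [Function.onFun, Finset.disjoint_left]
    intro S hv hw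
    have hv' := (Finset.mem_filter.mp hv).2
    have hw' := (Finset.mem_filter.mp hw).2
    exact hvw (Option.some.inj (hv'.symm.trans hw'))

/-- The losing scores over `T` sum to at least the number of `k`-subsets of `T`. -/
theorem choose_card_le_sum_losingScore {n k : ℕ} (H : Hypertournament n k) (hk : 0 < k)
    (T : Finset (Fin n)) : T.card.choose k ≤ ∑ v ∈ T, losingScore H v := by
  rw [sum_losingScore, ← Finset.card_powersetCard]
  refine Finset.card_le_card fun S hS => ?_
  obtain ⟨hST, hcard⟩ := Finset.mem_powersetCard.mp hS
  obtain ⟨v, hv, hlast⟩ := H.exists_getLast?_arc hk hcard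
  exact Finset.mem_filter.mpr
    ⟨Finset.mem_powersetCard.mpr ⟨Finset.subset_univ S, hcard⟩, v, hST hv, hlast⟩

/-- The losing scores sum to the number of arcs. -/
theorem sum_univ_losingScore {n k : ℕ} (H : Hypertournament n k) (hk : 0 < k) :
    ∑ v, losingScore H v = n.choose k := by
  refine le_antisymm ?_ (by simpa using choose_card_le_sum_losingScore H hk Finset.univ)
  rw [sum_losingScore]
  exact (Finset.card_filter_le _ _).trans (by simp)

/-- Necessity: the losing scores of a `k`-hypertournament, listed in
non-decreasing order, satisfy the prefix-sum inequalities, with equality at `n`. -/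
theorem losing_scores_prefix_sums (n k : ℕ) (hk : 1 < k) (hkn : k ≤ n)
    (H : Hypertournament n k) (r : Fin n → ℕ) (hr : Monotone r)
    (σ : Equiv.Perm (Fin n)) (hσ : ∀ i : Fin n, r i = losingScore H (σ i)) :
    (∀ j : ℕ, 1 ≤ j → j ≤ n →
        Nat.choose j k ≤ ∑ i ∈ Finset.univ.filter (fun i : Fin n => (i : ℕ) < j), r i) ∧
      ∑ i : Fin n, r i = Nat.choose n k := by
  refine ⟨fun j _ hj => ?_, ?_⟩
  · have h := choose_card_le_sum_losingScore H (by omega)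
      ((Finset.univ.filter (fun i : Fin n => (i : ℕ) < j)).map σ.toEmbedding)
    rw [Finset.card_map, Finset.sum_map, Fin.card_filter_val_lt, min_eq_right hj] at h
    simpa [hσ] using h
  · simp only [hσ]
    rw [Equiv.sum_comp σ (losingScore H)]
    exact sum_univ_losingScore H (by omega)
end

section
/- Let n and k be integers with n ≥ k > 1, and let r₁ ≤ r₂ ≤ … ≤ rₙ be a non-decreasing sequence of non-negative integers such that ∑_{i=1}^{j} rᵢ ≥ C(j, k) for each j with 1 ≤ j ≤ n, with equality when j = n. Then there exists a k-hypertournament on n vertices whose losing scores, listed in non-decreasing order, are exactly r₁, r₂, …, rₙ. -/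
/-- A strictly monotone map between initial segments of the naturals is inflationary. -/
theorem StrictMono.val_le_val_apply {m n : ℕ} {f : Fin m → Fin n} (hf : StrictMono f)
    (i : Fin m) : (i : ℕ) ≤ f i := by
  obtain ⟨i, hi⟩ := i
  induction i with
  | zero => simp
  | succ i ih =>
    have h : f ⟨i, by omega⟩ < f ⟨i + 1, hi⟩ := hf (by simp)
    have := ih (by omega)
    simp only [Fin.lt_def] at h this ⊢
    omega

/-- Among the sets of a given size, the initial segment minimizes the sum of a monotone
function. -/
theorem Monotone.sum_filter_lt_card_le {n : ℕ} {r : Fin n → ℕ} (hr : Monotone r)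
    (U : Finset (Fin n)) :
    ∑ i ∈ Finset.univ.filter (fun i : Fin n => (i : ℕ) < U.card), r i ≤ ∑ i ∈ U, r i := by
  have hU : U.card ≤ n := by simpa using U.card_le_univ
  have hl : Finset.univ.filter (fun i : Fin n => (i : ℕ) < U.card) =
      Finset.univ.map (Fin.castLEEmb hU) := by
    ext i
    simp only [Finset.mem_filter, Finset.mem_univ, true_and, Finset.mem_map]
    exact ⟨fun h => ⟨⟨i, h⟩, rfl⟩, by rintro ⟨a, rfl⟩; exact a.2⟩
  have hR : U = Finset.univ.map (U.orderEmbOfFin rfl).toEmbedding :=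
    (Finset.map_orderEmbOfFin_univ U rfl).symm
  rw [hl]
  conv_rhs => rw [hR]
  rw [Finset.sum_map, Finset.sum_map]
  exact Finset.sum_le_sum fun i _ =>
    hr (Fin.le_def.2 ((U.orderEmbOfFin rfl).strictMono.val_le_val_apply i))

/-- If every set `U` of vertices contains at most `∑ v ∈ U, r v` of the `k`-element sets, then
one can select an element of each `k`-element set so that no `v` is selected more than `r v`
times. -/
theorem exists_selection_of_choose_le_sum {α : Type*} [Fintype α] [DecidableEq α] (k : ℕ)
    (r : α → ℕ) (h : ∀ U : Finset α, U.card.choose k ≤ ∑ v ∈ U, r v) :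
    ∃ g : {S : Finset α // S.card = k} → α, (∀ S, g S ∈ S.1) ∧
      ∀ v, (Finset.univ.filter fun S => g S = v).card ≤ r v := by
  let t : {S : Finset α // S.card = k} → Finset (Σ v, Fin (r v)) :=
    fun S => S.1.sigma fun _ => Finset.univ
  have hall : ∀ A : Finset {S : Finset α // S.card = k}, A.card ≤ (A.biUnion t).card := by
    intro A
    have hb : A.biUnion t = (A.biUnion Subtype.val).sigma fun _ => Finset.univ := by
      ext ⟨v, i⟩
      simp [t]
    have hc : (A.map (Function.Embedding.subtype _)) ⊆
        (A.biUnion Subtype.val).powersetCard k := by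
      intro S hS
      obtain ⟨T, hT, rfl⟩ := Finset.mem_map.1 hS
      exact Finset.mem_powersetCard.2 ⟨Finset.subset_biUnion_of_mem Subtype.val hT, T.2⟩
    have := Finset.card_le_card hc
    rw [Finset.card_map, Finset.card_powersetCard] at this
    rw [hb, Finset.card_sigma]
    simpa using this.trans (h _)
  obtain ⟨f, hf, hft⟩ := (Finset.all_card_le_biUnion_card_iff_exists_injective t).1 hall
  refine ⟨fun S => (f S).1, fun S => (Finset.mem_sigma.1 (hft S)).1, fun v => ?_⟩
  calc (Finset.univ.filter fun S => (f S).1 = v).card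
      ≤ (({v} : Finset α).sigma fun v => (Finset.univ : Finset (Fin (r v)))).card := by
        refine Finset.card_le_card_of_injOn f (fun S hS => ?_) hf.injOn
        simpa using hS
    _ = r v := by simp

/-- Every selection of an element from each `k`-element set is the family of last entries of
some `k`-hypertournament. -/
theorem exists_hypertournament_losingScore_eq {n k : ℕ}
    (g : {S : Finset (Fin n) // S.card = k} → Fin n) (hg : ∀ S, g S ∈ S.1) :
    ∃ H : Hypertournament n k, ∀ v,
      losingScore H v = (Finset.univ.filter fun S => g S = v).card := by
  refine ⟨⟨fun S => if h : S.card = k then (S.erase (g ⟨S, h⟩)).toList ++ [g ⟨S, h⟩] else [],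
    fun S h => ?_, fun S h => ?_⟩, fun v => ?_⟩
  · simp +contextual [h, List.nodup_append, Finset.nodup_toList]
  · simp only [h, dite_true]
    ext x
    have := hg ⟨S, h⟩
    by_cases hx : x = g ⟨S, h⟩ <;> simp_all
  · rw [losingScore, ← Finset.card_map (Function.Embedding.subtype _)]
    congr 1
    ext S
    by_cases h : S.card = k <;> simp [h, Finset.mem_powersetCard]

/-- Sufficiency: a non-decreasing sequence of non-negative integers satisfying the
prefix-sum inequalities (with equality at `n`) is the losing score sequence of some
`k`-hypertournament on `n` vertices. -/
theorem exists_hypertournament_of_prefix_sums (n k : ℕ) (hk : 1 < k) (hkn : k ≤ n)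
    (r : Fin n → ℕ) (hr : Monotone r)
    (hineq : ∀ j : ℕ, 1 ≤ j → j ≤ n →
        Nat.choose j k ≤ ∑ i ∈ Finset.univ.filter (fun i : Fin n => (i : ℕ) < j), r i)
    (heq : ∑ i : Fin n, r i = Nat.choose n k) :
    ∃ H : Hypertournament n k, ∃ σ : Equiv.Perm (Fin n),
      ∀ i : Fin n, r i = losingScore H (σ i) := by
  have hU : ∀ U : Finset (Fin n), U.card.choose k ≤ ∑ v ∈ U, r v := by
    intro U
    rcases Nat.eq_zero_or_pos U.card with h0 | hpos
    · simp [h0, Nat.choose_eq_zero_of_lt (show 0 < k by omega)]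
    · exact (hineq U.card hpos (by simpa using U.card_le_univ)).trans (hr.sum_filter_lt_card_le U)
  obtain ⟨g, hg, hle⟩ := exists_selection_of_choose_le_sum k r hU
  obtain ⟨H, hH⟩ := exists_hypertournament_losingScore_eq g hg
  have hsum : ∑ v, (Finset.univ.filter fun S => g S = v).card = ∑ v, r v := by
    rw [heq, ← Finset.card_eq_sum_card_fiberwise (fun _ _ => Finset.mem_coe.2 (Finset.mem_univ _)),
      Finset.card_univ, Fintype.card_finset_len, Fintype.card_fin]
  refine ⟨H, 1, fun i => ?_⟩
  rw [Equiv.Perm.one_apply, hH]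
  exact ((Finset.sum_eq_sum_iff_of_le fun v _ => hle v).1 hsum i (Finset.mem_univ i)).symm
end

section
/- A sequence of non-negative integers [s₁, s₂, …, sₙ] in non-decreasing order is the score sequence of some tournament on n vertices if and only if for each j with 1 ≤ j ≤ n, ∑_{i=1}^{j} sᵢ ≥ C(j, 2), with equality when j = n. -/
/-- In a tournament, the scores inside a finite vertex set `A` add up to `C(|A|, 2)`. -/
theorem sum_card_filter_tournament {V : Type*} [DecidableEq V] (T : V → V → Bool)
    (hirr : ∀ u, T u u = false) (hT : ∀ u v, u ≠ v → (T u v = true ↔ ¬ T v u = true))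
    (A : Finset V) :
    ∑ u ∈ A, (A.filter (fun w => T u w = true)).card = A.card.choose 2 := by
  have hoff : ∑ u ∈ A, ∑ v ∈ A, ((if T u v = true then 1 else 0) +
      (if T v u = true then 1 else 0)) = A.card * (A.card - 1) := by
    rw [← smul_eq_mul, ← Finset.sum_const]
    refine Finset.sum_congr rfl fun u hu => ?_
    rw [← Finset.card_erase_of_mem hu, ← Finset.filter_ne, Finset.card_filter]
    refine Finset.sum_congr rfl fun v _ => ?_
    by_cases huv : u = v
    · subst huv
      simp [hirr]
    · have := hT u v huv
      by_cases h : T v u = true <;> simp_all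
  simp only [Finset.sum_add_distrib] at hoff
  rw [Finset.sum_comm (f := fun u v => if T v u = true then 1 else 0)] at hoff
  simp only [Finset.card_filter]
  rw [Nat.choose_two_right]
  omega

/-- A monotone sequence has its smallest `k`-element sum on the initial segment. -/
theorem Monotone.sum_filter_val_lt_card_le {n : ℕ} {s : Fin n → ℕ} (hs : Monotone s)
    (A : Finset (Fin n)) :
    ∑ i ∈ Finset.univ.filter (fun i : Fin n => (i : ℕ) < A.card), s i ≤ ∑ i ∈ A, s i := by
  have hle : A.card ≤ n := by simpa using A.card_le_univ
  obtain hlt | heq := hle.lt_or_eq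
  · set B := Finset.univ.filter (fun i : Fin n => (i : ℕ) < A.card) with hB
    have hcard : B.card = A.card := by simp [hB, Fin.card_filter_val_lt, hle]
    rw [← Finset.sum_sdiff_le_sum_sdiff]
    calc ∑ i ∈ B \ A, s i ≤ (B \ A).card • s ⟨A.card, hlt⟩ :=
          Finset.sum_le_card_nsmul _ _ _ fun i hi => hs <| by
            simp only [hB, Finset.mem_sdiff, Finset.mem_filter] at hi
            exact Fin.le_def.2 hi.1.2.le
      _ = (A \ B).card • s ⟨A.card, hlt⟩ := by rw [Finset.card_sdiff_comm hcard]
      _ ≤ ∑ i ∈ A \ B, s i :=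
          Finset.card_nsmul_le_sum _ _ _ fun i hi => hs <| by
            simp only [hB, Finset.mem_sdiff, Finset.mem_filter] at hi
            exact Fin.le_def.2 (by simpa using hi.2)
  · have hA : A = Finset.univ := by simpa [← Finset.card_eq_iff_eq_univ] using heq
    rw [hA]
    exact Finset.sum_le_sum_of_subset (Finset.subset_univ _)

/-- If the prescribed scores on every vertex set `A` add up to at least `C(|A|, 2)`, with equality
for the full vertex set, then some tournament has these scores. The winner of each game is chosen
by Hall's theorem, matching games injectively with the `s v` wins available at each vertex `v`. -/
theorem exists_tournament_of_choose_two_le_sum {V : Type*} [Fintype V] [DecidableEq V]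
    (s : V → ℕ) (hle : ∀ A : Finset V, A.card.choose 2 ≤ ∑ v ∈ A, s v)
    (heq : ∑ v, s v = (Fintype.card V).choose 2) :
    ∃ T : V → V → Bool, (∀ u, T u u = false) ∧
      (∀ u v, u ≠ v → (T u v = true ↔ ¬ T v u = true)) ∧
      ∀ u, s u = (Finset.univ.filter (fun w => T u w = true)).card := by
  classical
  let wins : {e : Sym2 V // ¬ e.IsDiag} → Finset (Σ v, Fin (s v)) :=
    fun e => Finset.univ.filter fun p => p.1 ∈ e.1
  have hall : ∀ A : Finset {e : Sym2 V // ¬ e.IsDiag}, A.card ≤ (A.biUnion wins).card := by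
    intro A
    set B : Finset V := Finset.univ.filter fun v => ∃ e ∈ A, v ∈ e.1 with hB
    have hwins : A.biUnion wins = B.sigma fun _ => Finset.univ := by
      ext p
      simp [wins, hB]
    have hsub : A.image Subtype.val ⊆ B.offDiag.image Sym2.mk.uncurry := by
      intro e he
      obtain ⟨⟨e, hd⟩, heA, rfl⟩ := Finset.mem_image.1 he
      induction e with | h u v =>
      refine Finset.mem_image.2 ⟨(u, v), ?_, rfl⟩
      simp only [Finset.mem_offDiag, hB, Finset.mem_filter, Finset.mem_univ, true_and]
      exact ⟨⟨_, heA, Sym2.mem_mk_left u v⟩, ⟨_, heA, Sym2.mem_mk_right u v⟩, by simpa using hd⟩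
    calc A.card = (A.image Subtype.val).card :=
          (Finset.card_image_of_injective _ Subtype.val_injective).symm
      _ ≤ B.card.choose 2 := (Finset.card_le_card hsub).trans_eq (Sym2.card_image_offDiag B)
      _ ≤ ∑ v ∈ B, s v := hle B
      _ = (A.biUnion wins).card := by simp [hwins]
  obtain ⟨f, hinj, hf⟩ := (Finset.all_card_le_biUnion_card_iff_exists_injective wins).1 hall
  have hmem : ∀ e, (f e).1 ∈ e.1 := fun e => by simpa [wins] using hf e
  have hbij : Function.Bijective f := (Fintype.bijective_iff_injective_and_card f).2
    ⟨hinj, by rw [Sym2.card_subtype_not_diag]; simp [heq]⟩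
  have hdiag : ∀ {u v : V}, u ≠ v → ¬ s(u, v).IsDiag := fun h => by simpa using h
  let T : V → V → Bool := fun u v => decide (∃ h : u ≠ v, (f ⟨s(u, v), hdiag h⟩).1 = u)
  refine ⟨T, fun u => by simp [T], fun u v huv => ?_, fun u => ?_⟩
  · have hm := hmem ⟨s(u, v), hdiag huv⟩
    have hswap : (⟨s(v, u), hdiag huv.symm⟩ : {e : Sym2 V // ¬ e.IsDiag}) =
        ⟨s(u, v), hdiag huv⟩ := Subtype.ext Sym2.eq_swap
    simp only [T, decide_eq_true_eq, huv, huv.symm, ne_eq, not_false_eq_true, exists_true_left,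
      hswap]
    rcases Sym2.mem_iff.1 hm with h | h <;> simp [h, huv, huv.symm]
  · have hcard : (Finset.univ.filter fun p : Σ v, Fin (s v) => p.1 = u).card = s u := by
      have : (Finset.univ.filter fun p : Σ v, Fin (s v) => p.1 = u) =
          ({u} : Finset V).sigma fun _ => Finset.univ := by
        ext p
        simp
      simp [this]
    rw [← hcard]
    symm
    have hwin : ∀ {v}, v ∈ Finset.univ.filter (fun w => T u w = true) →
        ∃ h : u ≠ v, (f ⟨s(u, v), hdiag h⟩).1 = u := fun hv => by simpa [T] using hv
    refine Finset.card_bij (fun v hv => f ⟨s(u, v), hdiag (hwin hv).1⟩) ?_ ?_ ?_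
    · intro v hv
      simpa using (hwin hv).2
    · intro v hv w hw h
      exact Sym2.congr_right.1 (congrArg Subtype.val (hinj h))
    · intro p hp
      obtain ⟨⟨e, hd⟩, rfl⟩ := hbij.2 p
      have hpu : (f ⟨e, hd⟩).1 = u := by simpa using hp
      obtain ⟨v, rfl⟩ : u ∈ e := hpu ▸ hmem ⟨e, hd⟩
      have huv : u ≠ v := by simpa using hd
      exact ⟨v, by simpa [T] using ⟨huv, hpu⟩, rfl⟩


/-- **Landau's theorem.** A non-decreasing sequence `s` of non-negative integers is
the score sequence of some tournament on `n` vertices iff every prefix sum of length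
`j` is at least `C(j, 2)`, with equality for `j = n`.  A tournament is modelled as a
relation `T` with `T u u = false` and, for `u ≠ v`, exactly one of `T u v`, `T v u`
holding; the score of `v` is its out-degree. -/
theorem landau_score_sequence_iff (n : ℕ) (s : Fin n → ℕ) (hs : Monotone s) :
    (∃ T : Fin n → Fin n → Bool,
        (∀ u : Fin n, T u u = false) ∧
        (∀ u v : Fin n, u ≠ v → (T u v = true ↔ ¬ T v u = true)) ∧
        ∃ σ : Equiv.Perm (Fin n),
          ∀ i : Fin n,
            s i = (Finset.univ.filter (fun w : Fin n => T (σ i) w = true)).card) ↔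
      ((∀ j : ℕ, 1 ≤ j → j ≤ n →
          Nat.choose j 2 ≤ ∑ i ∈ Finset.univ.filter (fun i : Fin n => (i : ℕ) < j), s i) ∧
        ∑ i : Fin n, s i = Nat.choose n 2) := by
  constructor
  · rintro ⟨T, hirr, hT, σ, hσ⟩
    have hsum : ∀ A : Finset (Fin n), ∑ i ∈ A, s i =
        ∑ u ∈ A.map σ.toEmbedding, (Finset.univ.filter (fun w => T u w = true)).card := by
      intro A
      simp [hσ]
    refine ⟨fun j _ hj => ?_, ?_⟩
    · set A := Finset.univ.filter (fun i : Fin n => (i : ℕ) < j) with hA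
      have hcard : (A.map σ.toEmbedding).card = j := by simp [hA, Fin.card_filter_val_lt, hj]
      rw [hsum, ← hcard, ← sum_card_filter_tournament T hirr hT]
      exact Finset.sum_le_sum fun u _ =>
        Finset.card_le_card (Finset.filter_subset_filter _ (Finset.subset_univ _))
    · rw [hsum, Finset.map_univ_equiv, sum_card_filter_tournament T hirr hT, Finset.card_fin]
  · rintro ⟨hle, heq⟩
    have hsub : ∀ A : Finset (Fin n), A.card.choose 2 ≤ ∑ v ∈ A, s v := by
      intro A
      rcases A.card.eq_zero_or_pos with h | h
      · simp [h]
      · exact (hle _ h (by simpa using A.card_le_univ)).trans (hs.sum_filter_val_lt_card_le A)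
    obtain ⟨T, hirr, hT, hscore⟩ :=
      exists_tournament_of_choose_two_le_sum s hsub (by rw [heq, Fintype.card_fin])
    exact ⟨T, hirr, hT, Equiv.refl _, hscore⟩
end

section
/- Let n and k be integers with n ≥ k > 1, let H be a k-hypertournament on a vertex set V with |V| = n, and let S be any subset of V. Then the sum of the losing scores of the vertices in S satisfies ∑_{v ∈ S} r(v) ≥ C(|S|, k), with equality when S = V. -/
theorem Hypertournament.exists_getLast?_arc_eq {n k : ℕ} (hk : 0 < k) (H : Hypertournament n k)
    {T : Finset (Fin n)} (hT : T.card = k) : ∃ v ∈ T, (H.arc T).getLast? = some v := by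
  have harc := H.toFinset_arc T hT
  have hne : H.arc T ≠ [] := by
    intro h
    rw [h, List.toFinset_nil] at harc
    simp [← harc] at hT
    omega
  refine ⟨(H.arc T).getLast hne, ?_, List.getLast?_eq_some_getLast hne⟩
  conv_lhs => rw [← harc]
  exact List.mem_toFinset.2 (List.getLast_mem hne)

theorem sum_losingScore_eq_card {n k : ℕ} (H : Hypertournament n k) (S : Finset (Fin n)) :
    ∑ v ∈ S, losingScore H v = ((Finset.univ.powersetCard k).filter
      (fun T : Finset (Fin n) => ∃ v ∈ S, (H.arc T).getLast? = some v)).card := by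
  classical
  unfold losingScore
  rw [← Finset.card_biUnion]
  · congr 1
    ext T
    simp only [Finset.mem_biUnion, Finset.mem_filter]
    tauto
  · intro v _ w _ hvw
    refine Finset.disjoint_filter.2 fun T _ hv hw => hvw ?_
    exact Option.some_injective _ (hv.symm.trans hw)

/-- For any subset `S` of the vertices of a `k`-hypertournament, the sum of the
losing scores over `S` is at least `C(|S|, k)`, with equality when `S` is the whole
vertex set. -/
theorem sum_losingScore_subset (n k : ℕ) (hk : 1 < k) (hkn : k ≤ n)
    (H : Hypertournament n k) (S : Finset (Fin n)) :
    Nat.choose S.card k ≤ ∑ v ∈ S, losingScore H v ∧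
      (S = Finset.univ → ∑ v ∈ S, losingScore H v = Nat.choose S.card k) := by
  have hlast {T : Finset (Fin n)} (hT : T.card = k) :=
    H.exists_getLast?_arc_eq (zero_lt_one.trans hk) hT
  rw [sum_losingScore_eq_card]
  constructor
  · rw [← Finset.card_powersetCard]
    refine Finset.card_le_card fun T hT => ?_
    obtain ⟨hTS, hcard⟩ := Finset.mem_powersetCard.1 hT
    obtain ⟨v, hv, hvT⟩ := hlast hcard
    exact Finset.mem_filter.2
      ⟨Finset.mem_powersetCard.2 ⟨T.subset_univ, hcard⟩, v, hTS hv, hvT⟩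
  · rintro rfl
    rw [← Finset.card_powersetCard, Finset.filter_true_of_mem]
    intro T hT
    obtain ⟨v, -, hv⟩ := hlast (Finset.mem_powersetCard.1 hT).2
    exact ⟨v, Finset.mem_univ v, hv⟩
end
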